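/- Let (Y,ν) be a σ-finite measure space, g : Y → ℝ⁺ measurable with ‖g‖_{L¹(ν)} < ∞, and let t > 0. Then g*(λ_{g*}(t)) = t if and only if for every s with 0 < s < t one has λ_{g*}(s) > λ_{g*}(t); here g* is the nonincreasing rearrangement of g (a function on (0,∞) with Lebesgue measure) and λ_{g*} is its distribution function with respect to Lebesgue measure. -/

import Mathlib

open MeasureTheory ENNReal

/-- The distribution function `λ_f(s) = μ({x : |f(x)| > s})`. -/
noncomputable def distFn {α : Type*} [MeasurableSpace α] (μ : Measure α) (f : α → ℝ)
    (s : ℝ) : ℝ≥0∞ :=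
  μ {x | s < |f x|}

/-- The nonincreasing rearrangement `f*(t) = inf{s > 0 : λ_f(s) ≤ t}` (with value `∞` if no
such `s` exists). -/
noncomputable def rearr {α : Type*} [MeasurableSpace α] (μ : Measure α) (f : α → ℝ)
    (t : ℝ) : ℝ≥0∞ :=
  sInf (ENNReal.ofReal '' {s : ℝ | 0 < s ∧ distFn μ f s ≤ ENNReal.ofReal t})

/-- The distribution function `λ_f(s) = μ({x : f(x) > s})` of an `ℝ≥0∞`-valued function. -/
noncomputable def distFnE {α : Type*} [MeasurableSpace α] (μ : Measure α) (f : α → ℝ≥0∞)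
    (s : ℝ) : ℝ≥0∞ :=
  μ {x | ENNReal.ofReal s < f x}

/-- The distribution function is lower semicontinuous from the right. -/
theorem exists_gt_lt_distFn {α : Type*} [MeasurableSpace α] {μ : Measure α} {f : α → ℝ}
    {t : ℝ} {c : ℝ≥0∞} (h : c < distFn μ f t) : ∃ u, t < u ∧ c < distFn μ f u := by
  have hU : {x | t < |f x|} = ⋃ n : ℕ, {x | t + 1 / ((n : ℝ) + 1) < |f x|} := by
    ext x
    simp only [Set.mem_ofPred_eq, Set.mem_iUnion]
    constructor
    · intro hx
      obtain ⟨n, hn⟩ := exists_nat_one_div_lt (sub_pos.2 hx)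
      exact ⟨n, by linarith⟩
    · rintro ⟨n, hn⟩
      have : (0 : ℝ) < 1 / ((n : ℝ) + 1) := Nat.one_div_pos_of_nat
      linarith
  have hmono : Monotone fun n : ℕ => {x | t + 1 / ((n : ℝ) + 1) < |f x|} := by
    intro m n hmn x hx
    have : 1 / ((n : ℝ) + 1) ≤ 1 / ((m : ℝ) + 1) := Nat.one_div_le_one_div hmn
    simp only [Set.mem_ofPred_eq] at hx ⊢
    linarith
  rw [distFn, hU, hmono.measure_iUnion, lt_iSup_iff] at h
  obtain ⟨n, hn⟩ := h
  exact ⟨_, lt_add_of_pos_right t Nat.one_div_pos_of_nat, hn⟩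

theorem distFn_anti {α : Type*} [MeasurableSpace α] (μ : Measure α) (f : α → ℝ) :
    Antitone (distFn μ f) :=
  fun _ _ h => measure_mono fun _ hx => lt_of_le_of_lt h hx

theorem ofReal_lt_rearr_iff {α : Type*} [MeasurableSpace α] {μ : Measure α} {f : α → ℝ}
    {t : ℝ} (ht : 0 < t) (x : ℝ) :
    ENNReal.ofReal t < rearr μ f x ↔ ENNReal.ofReal x < distFn μ f t := by
  constructor
  · intro h
    by_contra! hle
    exact h.not_ge (sInf_le ⟨t, ⟨ht, hle⟩, rfl⟩)
  · intro h
    obtain ⟨u, htu, hu⟩ := exists_gt_lt_distFn h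
    refine ((ENNReal.ofReal_lt_ofReal_iff (ht.trans htu)).2 htu).trans_le (le_sInf ?_)
    rintro _ ⟨s, ⟨-, hs⟩, rfl⟩
    refine ENNReal.ofReal_le_ofReal (le_of_not_gt fun hsu => ?_)
    exact (hu.trans_le (distFn_anti μ f hsu.le)).not_ge hs

/-- A function and its rearrangement are equimeasurable. -/
theorem distFnE_rearr {α : Type*} [MeasurableSpace α] {μ : Measure α} {f : α → ℝ}
    {t : ℝ} (ht : 0 < t) (hfin : distFn μ f t ≠ ⊤) :
    distFnE (volume.restrict (Set.Ioi 0)) (rearr μ f) t = distFn μ f t := by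
  have hset : {x : ℝ | ENNReal.ofReal t < rearr μ f x} ∩ Set.Ioi 0 =
      Set.Ioo 0 (distFn μ f t).toReal := by
    ext x
    simp only [Set.mem_inter_iff, Set.mem_ofPred_eq, Set.mem_Ioi, Set.mem_Ioo,
      ofReal_lt_rearr_iff ht]
    rw [and_comm]
    exact and_congr_right fun hx => ENNReal.ofReal_lt_iff_lt_toReal hx.le hfin
  rw [distFnE, Measure.restrict_apply' measurableSet_Ioi, hset, Real.volume_Ioo, sub_zero,
    ENNReal.ofReal_toReal hfin]

theorem distFn_ne_top {α : Type*} [MeasurableSpace α] {μ : Measure α} {f : α → ℝ}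
    (hf : Measurable f) (hf0 : ∀ x, 0 ≤ f x) (hL1 : ∫⁻ x, ENNReal.ofReal (f x) ∂μ < ⊤)
    {t : ℝ} (ht : 0 < t) : distFn μ f t ≠ ⊤ := by
  have h := meas_ge_le_lintegral_div (μ := μ) hf.ennreal_ofReal.aemeasurable
    (ENNReal.ofReal_pos.2 ht).ne' ENNReal.ofReal_ne_top
  refine ((measure_mono fun x hx => ?_).trans_lt
    (h.trans_lt (ENNReal.div_lt_top hL1.ne (ENNReal.ofReal_pos.2 ht).ne'))).ne
  simp only [Set.mem_ofPred_eq, abs_of_nonneg (hf0 x)] at hx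
  exact ENNReal.ofReal_le_ofReal hx.le

/-- For `g` nonnegative with `‖g‖₁ < ∞` and `t > 0`: `g*(λ_{g*}(t)) = t` iff
`λ_{g*}(s) > λ_{g*}(t)` for every `0 < s < t`, where `g*` is regarded as a function on
`(0,∞)` with Lebesgue measure and `λ_{g*}` is its distribution function. -/
theorem rearr_distFn_eq_iff {Y : Type*} [MeasurableSpace Y] (ν : Measure Y) [SigmaFinite ν]
    (g : Y → ℝ) (hgm : Measurable g) (hg0 : ∀ y, 0 ≤ g y)
    (hL1 : ∫⁻ y, ENNReal.ofReal (g y) ∂ν < ⊤) (t : ℝ) (ht : 0 < t) :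
    rearr ν g ((distFnE (volume.restrict (Set.Ioi 0)) (rearr ν g) t).toReal) =
        ENNReal.ofReal t ↔
      ∀ s : ℝ, 0 < s → s < t →
        distFnE (volume.restrict (Set.Ioi 0)) (rearr ν g) t <
          distFnE (volume.restrict (Set.Ioi 0)) (rearr ν g) s := by
  have hfin : ∀ {s : ℝ}, 0 < s → distFn ν g s ≠ ⊤ := distFn_ne_top hgm hg0 hL1
  rw [distFnE_rearr ht (hfin ht)]
  have hr : ENNReal.ofReal (distFn ν g t).toReal = distFn ν g t :=
    ENNReal.ofReal_toReal (hfin ht)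
  constructor
  · intro h s hs hst
    rw [distFnE_rearr hs (hfin hs)]
    rw [← hr, ← ofReal_lt_rearr_iff hs, h]
    exact (ENNReal.ofReal_lt_ofReal_iff ht).2 hst
  · intro h
    refine le_antisymm (sInf_le ⟨t, ⟨ht, hr.ge⟩, rfl⟩) (le_sInf ?_)
    rintro _ ⟨s, ⟨hs, hle⟩, rfl⟩
    refine ENNReal.ofReal_le_ofReal (le_of_not_gt fun hst => ?_)
    have hlt := h s hs hst
    rw [distFnE_rearr hs (hfin hs)] at hlt
    exact hlt.not_ge (hle.trans_eq hr)
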